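/- Fix x ∈ ℝ^d, δ > 0, a batch size M ≥ 1, and a cardinality bound s̄ ≥ 1. Let (u^m, ξ^m), m = 1,…,M, be iid pairs where each u^m is a sign vector with iid entries uniform on {−1,1} independent of ξ^m. Define the mini-batch finite-difference estimator g^δ_Ŝ(x) = (1/M) Σ_{m=1}^M ((f(x + δu^m, ξ^m) − f(x, ξ^m))/δ) · (u^m)_Ŝ and the mini-batch gradient g_Ŝ(x) = (1/M) Σ_{m=1}^M ∇_Ŝ f(x, ξ^m). Then for every index subset Ŝ ⊆ {1,…,d} with |Ŝ| ≤ s̄, E[ ‖g^δ_Ŝ(x) − g_Ŝ(x)‖² ] ≤ L² δ² d³ + 4 s̄ (σ² + 2‖∇F(x)‖²)/M + 4σ²/M. -/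

import Mathlib

open MeasureTheory
open scoped BigOperators

/-- The random sign vector `u ∈ {−1,1}^d` encoded by a boolean vector. -/
noncomputable def signVec (d : ℕ) (u : Fin d → Bool) : EuclideanSpace ℝ (Fin d) :=
  (WithLp.equiv 2 (Fin d → ℝ)).symm (fun i => if u i then (1 : ℝ) else -1)

/-- The quadratic upper bound on the first-order Taylor remainder of a function whose gradient is
Lipschitz. -/
theorem abs_sub_sub_inner_le_of_gradient_lipschitz {E : Type*} [NormedAddCommGroup E]
    [InnerProductSpace ℝ E] [CompleteSpace E] {f : E → ℝ} {f' : E → E} {L : ℝ}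
    (hgrad : ∀ y, HasGradientAt f (f' y) y)
    (hlip : ∀ y₁ y₂, ‖f' y₁ - f' y₂‖ ≤ L * ‖y₁ - y₂‖) (x v : E) :
    |f (x + v) - f x - inner ℝ (f' x) v| ≤ L / 2 * ‖v‖ ^ 2 := by
  have hderiv : ∀ t : ℝ, HasDerivAt (fun t : ℝ => f (x + t • v) - f x - t * inner ℝ (f' x) v)
      (inner ℝ (f' (x + t • v)) v - inner ℝ (f' x) v) t := by
    intro t
    have hline : HasDerivAt (fun t : ℝ => x + t • v) v t := by
      simpa using ((hasDerivAt_id t).smul_const v).const_add x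
    have hcomp := (hgrad (x + t • v)).hasFDerivAt.comp_hasDerivAt t hline
    exact ((hcomp.sub_const (f x)).sub
      ((hasDerivAt_id t).mul_const (inner ℝ (f' x) v))).congr_deriv
        (by simp [InnerProductSpace.toDual_apply_apply])
  have hbound : ∀ t : ℝ, HasDerivAt (fun t : ℝ => L / 2 * ‖v‖ ^ 2 * t ^ 2)
      (L * ‖v‖ ^ 2 * t) t := by
    intro t
    exact ((hasDerivAt_pow 2 t).const_mul (L / 2 * ‖v‖ ^ 2)).congr_deriv (by push_cast; ring)
  have h := image_norm_le_of_norm_deriv_right_le_deriv_boundary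
    (f := fun t : ℝ => f (x + t • v) - f x - t * inner ℝ (f' x) v) (a := 0) (b := 1)
    (fun t _ => (hderiv t).continuousAt.continuousWithinAt)
    (fun t _ => (hderiv t).hasDerivWithinAt) (by simp) hbound
    (fun t ht => by
      rw [← inner_sub_left]
      refine (norm_inner_le_norm _ _).trans ?_
      have h₁ := hlip (x + t • v) x
      rw [add_sub_cancel_left, norm_smul, Real.norm_of_nonneg ht.1] at h₁
      nlinarith [mul_le_mul_of_nonneg_right h₁ (norm_nonneg v)])
    (Set.right_mem_Icc.2 zero_le_one)
  simpa using h

/-- A finite orthogonal system of `±1`-valued functions satisfies Parseval's identity. -/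
theorem sum_sq_sum_mul_eq_of_orthogonal {α ι : Type*} [Fintype α] (s : Finset ι)
    (c : ι → ℝ) (χ : ι → α → ℝ) (hsq : ∀ p ∈ s, ∀ a, χ p a ^ 2 = 1)
    (horth : ∀ p ∈ s, ∀ q ∈ s, p ≠ q → ∑ a, χ p a * χ q a = 0) :
    ∑ a, (∑ p ∈ s, c p * χ p a) ^ 2 = Fintype.card α * ∑ p ∈ s, c p ^ 2 := by
  calc ∑ a, (∑ p ∈ s, c p * χ p a) ^ 2
      = ∑ p ∈ s, ∑ q ∈ s, c p * c q * ∑ a, χ p a * χ q a := by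
        simp_rw [sq, Finset.sum_mul_sum, Finset.mul_sum]
        rw [Finset.sum_comm]
        refine Finset.sum_congr rfl fun p _ => ?_
        rw [Finset.sum_comm]
        refine Finset.sum_congr rfl fun q _ => Finset.sum_congr rfl fun a _ => ?_
        ring
    _ = ∑ p ∈ s, c p ^ 2 * Fintype.card α := by
        refine Finset.sum_congr rfl fun p hp => ?_
        rw [Finset.sum_eq_single_of_mem p hp fun q hq hqp => by
          rw [horth p hp q hq hqp.symm, mul_zero]]
        simp [← sq, hsq p hp]
    _ = _ := by rw [Finset.mul_sum]; simp_rw [mul_comm]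

theorem signVec_apply {d : ℕ} (u : Fin d → Bool) (i : Fin d) :
    signVec d u i = if u i then (1 : ℝ) else -1 := rfl

theorem signVec_sq {d : ℕ} (u : Fin d → Bool) (i : Fin d) : signVec d u i ^ 2 = 1 := by
  rw [signVec_apply]; split_ifs <;> norm_num

theorem norm_signVec_sq {d : ℕ} (u : Fin d → Bool) : ‖signVec d u‖ ^ 2 = d := by
  simp [EuclideanSpace.real_norm_sq_eq, signVec_sq]

theorem signVec_update_not {d : ℕ} (u : Fin d → Bool) (i j : Fin d) :
    signVec d (Function.update u j (!u j)) i =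
      if i = j then -signVec d u i else signVec d u i := by
  by_cases h : i = j
  · subst h
    cases hu : u i <;> simp [signVec_apply, hu]
  · simp [signVec_apply, h]

theorem sum_signVec_mul_orthogonal {ι : Type*} [Fintype ι] [DecidableEq ι] {d : ℕ} (i : Fin d)
    {m n : ι} {j k : Fin d} (hj : j ≠ i) (hne : (m, j) ≠ (n, k)) :
    ∑ U : ι → Fin d → Bool,
      (signVec d (U m) j * signVec d (U m) i) * (signVec d (U n) k * signVec d (U n) i) = 0 := by
  let flip : (ι → Fin d → Bool) → ι → Fin d → Bool := fun U =>
    Function.update U m (Function.update (U m) j (!U m j))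
  have hflip : Function.Involutive flip := by
    intro U
    simp [flip]
  have hsum := Equiv.sum_comp hflip.toPerm fun U : ι → Fin d → Bool =>
    (signVec d (U m) j * signVec d (U m) i) * (signVec d (U n) k * signVec d (U n) i)
  have hneg : ∀ U : ι → Fin d → Bool,
      (signVec d (flip U m) j * signVec d (flip U m) i) *
        (signVec d (flip U n) k * signVec d (flip U n) i) =
      -((signVec d (U m) j * signVec d (U m) i) *
        (signVec d (U n) k * signVec d (U n) i)) := by
    intro U
    by_cases hnm : n = m
    · subst hnm
      have hkj : k ≠ j := fun h => hne (by rw [h])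
      simp [flip, signVec_update_not, hj.symm, hkj]
    · simp [flip, signVec_update_not, hj.symm, hnm]
  simp only [Function.Involutive.coe_toPerm, hneg, Finset.sum_neg_distrib] at hsum
  linarith

/-- The second moment of the `i`-th coordinate of the batch sum of
`⟪g m, u⟫ u - g m` over independent uniform sign vectors `u`. -/
theorem sum_sq_sum_inner_signVec_le {ι : Type*} [Fintype ι] [DecidableEq ι] {d : ℕ} (i : Fin d)
    (g : ι → EuclideanSpace ℝ (Fin d)) :
    ∑ U : ι → Fin d → Bool,
      (∑ m, (inner ℝ (g m) (signVec d (U m)) * signVec d (U m) i - g m i)) ^ 2 ≤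
      ((2 : ℝ) ^ d) ^ Fintype.card ι * ∑ m, ‖g m‖ ^ 2 := by
  have hexpand : ∀ U : ι → Fin d → Bool,
      ∑ m, (inner ℝ (g m) (signVec d (U m)) * signVec d (U m) i - g m i) =
        ∑ p ∈ Finset.univ ×ˢ Finset.univ.erase i,
          g p.1 p.2 * (signVec d (U p.1) p.2 * signVec d (U p.1) i) := by
    intro U
    rw [Finset.sum_product]
    refine Finset.sum_congr rfl fun m _ => ?_
    rw [Finset.sum_erase_eq_sub (Finset.mem_univ i), ← sq (signVec d (U m) i), signVec_sq,
      mul_one, PiLp.inner_apply, Finset.sum_mul]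
    congr 1
    refine Finset.sum_congr rfl fun j _ => ?_
    simp
    ring
  simp_rw [hexpand]
  rw [sum_sq_sum_mul_eq_of_orthogonal _ (fun p : ι × Fin d => g p.1 p.2)
    (fun (p : ι × Fin d) (U : ι → Fin d → Bool) => signVec d (U p.1) p.2 * signVec d (U p.1) i)
    (fun p _ U => by rw [mul_pow, signVec_sq, signVec_sq, one_mul])
    (fun p hp q _ hpq => sum_signVec_mul_orthogonal i
      (by simpa using hp) hpq), Finset.sum_product]
  have hcard : (Fintype.card (ι → Fin d → Bool) : ℝ) = ((2 : ℝ) ^ d) ^ Fintype.card ι := by simp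
  rw [hcard]
  refine mul_le_mul_of_nonneg_left (Finset.sum_le_sum fun m _ => ?_) (by positivity)
  rw [EuclideanSpace.real_norm_sq_eq]
  exact Finset.sum_le_sum_of_subset_of_nonneg (Finset.erase_subset _ _)
    fun _ _ _ => sq_nonneg _

/-- The error of one coordinate of the mini-batch finite-difference estimator splits into a
bias of size `L * δ * d / 2` and a term that is linear in the gradients. -/
theorem sq_finiteDifference_sub_gradient_le {ι : Type*} [Fintype ι] {d : ℕ}
    {f : ι → EuclideanSpace ℝ (Fin d) → ℝ}
    {f' : ι → EuclideanSpace ℝ (Fin d) → EuclideanSpace ℝ (Fin d)} {L δ c : ℝ}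
    (hgrad : ∀ m y, HasGradientAt (f m) (f' m y) y)
    (hlip : ∀ m y₁ y₂, ‖f' m y₁ - f' m y₂‖ ≤ L * ‖y₁ - y₂‖) (hδ : 0 < δ)
    (hc : c * Fintype.card ι = 1)
    (x : EuclideanSpace ℝ (Fin d)) (U : ι → Fin d → Bool) (i : Fin d) :
    (c * (∑ m, ((f m (x + δ • signVec d (U m)) - f m x) / δ) * signVec d (U m) i)
        - c * (∑ m, f' m x i)) ^ 2 ≤
      (L * δ * d) ^ 2 / 2 + 2 * (c * ∑ m,
        (inner ℝ (f' m x) (signVec d (U m)) * signVec d (U m) i - f' m x i)) ^ 2 := by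
  set r : ι → ℝ := fun m => (f m (x + δ • signVec d (U m)) - f m x) / δ -
    inner ℝ (f' m x) (signVec d (U m)) with hr
  have hrm : ∀ m, |r m * signVec d (U m) i| ≤ L * δ * d / 2 := by
    intro m
    have h := abs_sub_sub_inner_le_of_gradient_lipschitz (hgrad m) (hlip m) x
      (δ • signVec d (U m))
    have hs : |signVec d (U m) i| = 1 := by
      rw [← sq_eq_sq₀ (abs_nonneg _) zero_le_one, sq_abs, signVec_sq, one_pow]
    have hrδ : r m = (f m (x + δ • signVec d (U m)) - f m x -
        inner ℝ (f' m x) (δ • signVec d (U m))) / δ := by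
      rw [hr, real_inner_smul_right]
      field_simp
    rw [norm_smul, mul_pow, norm_signVec_sq, Real.norm_of_nonneg hδ.le] at h
    rw [abs_mul, hs, mul_one, hrδ, abs_div, abs_of_pos hδ, div_le_iff₀ hδ]
    linarith
  have hc0 : 0 ≤ c := by
    by_contra! hneg
    nlinarith [mul_nonneg (neg_nonneg.2 hneg.le) (Nat.cast_nonneg (α := ℝ) (Fintype.card ι))]
  have hbias : |c * ∑ m, r m * signVec d (U m) i| ≤ L * δ * d / 2 := by
    rw [abs_mul, abs_of_nonneg hc0]
    calc c * |∑ m, r m * signVec d (U m) i|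
        ≤ c * ∑ _m : ι, L * δ * d / 2 :=
          mul_le_mul_of_nonneg_left ((Finset.abs_sum_le_sum_abs _ _).trans
            (Finset.sum_le_sum fun m _ => hrm m)) hc0
      _ = L * δ * d / 2 := by
          rw [Finset.sum_const, Finset.card_univ, nsmul_eq_mul, ← mul_assoc, hc, one_mul]
  have hsplit : c * (∑ m, ((f m (x + δ • signVec d (U m)) - f m x) / δ) * signVec d (U m) i)
        - c * (∑ m, f' m x i) = c * (∑ m, r m * signVec d (U m) i) + c * ∑ m,
        (inner ℝ (f' m x) (signVec d (U m)) * signVec d (U m) i - f' m x i) := by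
    rw [← mul_sub, ← mul_add, ← Finset.sum_sub_distrib, ← Finset.sum_add_distrib]
    congr 1
    refine Finset.sum_congr rfl fun m _ => ?_
    rw [hr]
    ring
  rw [hsplit]
  have hsq := sq_le_sq' (abs_le.1 hbias).1 (abs_le.1 hbias).2
  refine (add_sq_le).trans ?_
  linarith

/-- The second moment of a random vector is at most twice the sum of its second moment about a
point `c` and `‖c‖ ^ 2`. -/
theorem integral_norm_sq_le {Ω E : Type*} [MeasurableSpace Ω] [NormedAddCommGroup E]
    {μ : Measure Ω} [IsProbabilityMeasure μ] {X : Ω → E} (c : E)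
    (hvar : Integrable (fun ω => ‖X ω - c‖ ^ 2) μ) :
    ∫ ω, ‖X ω‖ ^ 2 ∂μ ≤ 2 * ∫ ω, ‖X ω - c‖ ^ 2 ∂μ + 2 * ‖c‖ ^ 2 := by
  calc ∫ ω, ‖X ω‖ ^ 2 ∂μ ≤ ∫ ω, (2 * ‖X ω - c‖ ^ 2 + 2 * ‖c‖ ^ 2) ∂μ := by
        refine integral_mono_of_nonneg (.of_forall fun ω => sq_nonneg _)
          ((hvar.const_mul 2).add (integrable_const _)) (.of_forall fun ω => ?_)
        have h := norm_add_le (X ω - c) c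
        rw [sub_add_cancel] at h
        have h' := pow_le_pow_left₀ (norm_nonneg _) h 2
        have h'' := add_sq_le (a := ‖X ω - c‖) (b := ‖c‖)
        simp only
        linarith
    _ = _ := by
        rw [integral_add (hvar.const_mul 2) (integrable_const _), integral_const_mul]
        simp

/-- Mini-batch variance bound for the finite-difference gradient estimator:
for iid pairs `(u^m, ξ^m)`, `m = 1,…,M`, with `u^m` uniform sign vectors independent of
`ξ^m`, one has for every index set `Ŝ` with `|Ŝ| ≤ s̄`,
`E[‖g^δ_Ŝ(x) − g_Ŝ(x)‖²] ≤ L²δ²d³ + 4 s̄ (σ² + 2‖∇F(x)‖²)/M + 4σ²/M`,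
where `g^δ_Ŝ(x) = (1/M) Σ_m ((f(x+δu^m,ξ^m) − f(x,ξ^m))/δ)(u^m)_Ŝ` and
`g_Ŝ(x) = (1/M) Σ_m ∇_Ŝ f(x,ξ^m)`; the expectation is the uniform average over the
`M`-tuples of sign vectors of the integral over the product distribution of
`(ξ^1,…,ξ^M)`. -/
theorem stmt_8 {d : ℕ} {Ω : Type*} [MeasurableSpace Ω]
    (μ : Measure Ω) [IsProbabilityMeasure μ]
    (f : EuclideanSpace ℝ (Fin d) → Ω → ℝ)
    (f' : EuclideanSpace ℝ (Fin d) → Ω → EuclideanSpace ℝ (Fin d))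
    (L σ : ℝ) (hL : 0 < L) (hσ : 0 ≤ σ)
    (hfmeas : ∀ y, Measurable (fun ω => f y ω))
    (hgrad : ∀ (ω : Ω) (y : EuclideanSpace ℝ (Fin d)),
      HasGradientAt (fun z => f z ω) (f' y ω) y)
    (hlip : ∀ (ω : Ω) (y₁ y₂ : EuclideanSpace ℝ (Fin d)),
      ‖f' y₁ ω - f' y₂ ω‖ ≤ L * ‖y₁ - y₂‖)
    (x : EuclideanSpace ℝ (Fin d)) (Fg : EuclideanSpace ℝ (Fin d))
    (hint : Integrable (fun ω => f' x ω) μ)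
    (hFg : Fg = ∫ ω, f' x ω ∂μ)
    (hvarint : Integrable (fun ω => ‖f' x ω - Fg‖ ^ 2) μ)
    (hvar : ∫ ω, ‖f' x ω - Fg‖ ^ 2 ∂μ ≤ σ ^ 2)
    (δ : ℝ) (hδ : 0 < δ) (M : ℕ) (hM : 1 ≤ M) (sbar : ℕ) (hsbar : 1 ≤ sbar)
    (S : Finset (Fin d)) (hS : S.card ≤ sbar) :
    (∑ U : Fin M → Fin d → Bool,
        ∫ ωs : Fin M → Ω,
          ∑ i ∈ S,
            ((M : ℝ)⁻¹ * (∑ m : Fin M,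
                ((f (x + δ • signVec d (U m)) (ωs m) - f x (ωs m)) / δ)
                  * signVec d (U m) i)
              - (M : ℝ)⁻¹ * (∑ m : Fin M, f' x (ωs m) i)) ^ 2
          ∂(Measure.pi fun _ : Fin M => μ)) / ((2 : ℝ) ^ d) ^ M
      ≤ L ^ 2 * δ ^ 2 * (d : ℝ) ^ 3
        + 4 * (sbar : ℝ) * (σ ^ 2 + 2 * ‖Fg‖ ^ 2) / M + 4 * σ ^ 2 / M := by
  have hM0 : (M : ℝ) ≠ 0 := by positivity
  have hL2 : MemLp (fun ω => f' x ω) 2 μ := by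
    have hdiff : MemLp (fun ω => f' x ω - Fg) 2 μ :=
      (memLp_two_iff_integrable_sq_norm (hint.1.sub aestronglyMeasurable_const)).2 hvarint
    simpa [Pi.add_def] using hdiff.add (memLp_const Fg)
  have hL2eval : ∀ m : Fin M, MemLp (fun ωs : Fin M → Ω => f' x (ωs m)) 2
      (Measure.pi fun _ : Fin M => μ) := fun m =>
    hL2.comp_measurePreserving (measurePreserving_eval (fun _ : Fin M => μ) m)
  have hsqint : ∀ m : Fin M, Integrable (fun ωs : Fin M → Ω => ‖f' x (ωs m)‖ ^ 2)
      (Measure.pi fun _ : Fin M => μ) := fun m =>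
    (memLp_two_iff_integrable_sq_norm (hL2eval m).1).1 (hL2eval m)
  set Z : (Fin M → Fin d → Bool) → (Fin M → Ω) → Fin d → ℝ := fun U ωs i =>
    ∑ m, (inner ℝ (f' x (ωs m)) (signVec d (U m)) * signVec d (U m) i - f' x (ωs m) i) with hZ
  have hZmem : ∀ U i, MemLp (fun ωs => Z U ωs i) 2 (Measure.pi fun _ : Fin M => μ) := by
    intro U i
    refine memLp_finsetSum _ fun m _ => ?_
    exact (((hL2eval m).inner_const (𝕜 := ℝ) (signVec d (U m))).mul_const
      (signVec d (U m) i)).sub ((hL2eval m).eval_piLp i)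
  have hmaj : ∀ U, Integrable (fun ωs => ∑ i ∈ S,
      ((L * δ * d) ^ 2 / 2 + 2 * ((M : ℝ)⁻¹ * Z U ωs i) ^ 2))
      (Measure.pi fun _ : Fin M => μ) := fun U =>
    integrable_finsetSum _ fun i _ => (integrable_const _).add
      (((hZmem U i).const_mul (M : ℝ)⁻¹).integrable_sq.const_mul 2)
  have hpoint : ∀ ωs : Fin M → Ω, ∑ U, ∑ i ∈ S,
      ((L * δ * d) ^ 2 / 2 + 2 * ((M : ℝ)⁻¹ * Z U ωs i) ^ 2) ≤
      ((2 : ℝ) ^ d) ^ M * (S.card * ((L * δ * d) ^ 2 / 2 +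
        2 * ((M : ℝ)⁻¹ ^ 2 * ∑ m, ‖f' x (ωs m)‖ ^ 2))) := by
    intro ωs
    rw [Finset.sum_comm, mul_left_comm, ← nsmul_eq_mul]
    refine Finset.sum_le_card_nsmul _ _ _ fun i _ => ?_
    have h := sum_sq_sum_inner_signVec_le i fun m => f' x (ωs m)
    rw [Fintype.card_fin] at h
    have h' := mul_le_mul_of_nonneg_left h (show 0 ≤ 2 * (M : ℝ)⁻¹ ^ 2 by positivity)
    simp_rw [mul_pow]
    rw [Finset.sum_add_distrib, ← Finset.mul_sum, ← Finset.mul_sum, Finset.sum_const,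
      Finset.card_univ, nsmul_eq_mul]
    have hcard : (Fintype.card (Fin M → Fin d → Bool) : ℝ) = ((2 : ℝ) ^ d) ^ M := by simp
    rw [hcard]
    linarith
  have hG : ∫ ω, ‖f' x ω‖ ^ 2 ∂μ ≤ 2 * σ ^ 2 + 2 * ‖Fg‖ ^ 2 :=
    (integral_norm_sq_le Fg hvarint).trans (by linarith)
  have hsumint : ∫ ωs : Fin M → Ω, ∑ m, ‖f' x (ωs m)‖ ^ 2 ∂(Measure.pi fun _ : Fin M => μ) =
      M * ∫ ω, ‖f' x ω‖ ^ 2 ∂μ := by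
    rw [integral_finsetSum _ fun m _ => hsqint m]
    simp_rw [integral_comp_eval (μ := fun _ : Fin M => μ) (f := fun ω => ‖f' x ω‖ ^ 2)
      (hint.1.norm.pow 2)]
    simp
  have hsumintble : Integrable (fun ωs : Fin M → Ω => ∑ m, ‖f' x (ωs m)‖ ^ 2)
      (Measure.pi fun _ : Fin M => μ) := integrable_finsetSum _ fun m _ => hsqint m
  rw [div_le_iff₀' (by positivity)]
  calc _ ≤ ∑ U, ∫ ωs, ∑ i ∈ S, ((L * δ * d) ^ 2 / 2 + 2 * ((M : ℝ)⁻¹ * Z U ωs i) ^ 2)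
        ∂(Measure.pi fun _ : Fin M => μ) := by
        refine Finset.sum_le_sum fun U _ => integral_mono_of_nonneg
          (.of_forall fun ωs => Finset.sum_nonneg fun i _ => sq_nonneg _) (hmaj U)
          (.of_forall fun ωs => Finset.sum_le_sum fun i _ => ?_)
        exact sq_finiteDifference_sub_gradient_le (f := fun m y => f y (ωs m))
          (f' := fun m y => f' y (ωs m)) (fun m => hgrad (ωs m)) (fun m => hlip (ωs m)) hδ
          (by rw [Fintype.card_fin, inv_mul_cancel₀ hM0]) x U i
    _ = ∫ ωs, ∑ U, ∑ i ∈ S, ((L * δ * d) ^ 2 / 2 + 2 * ((M : ℝ)⁻¹ * Z U ωs i) ^ 2)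
        ∂(Measure.pi fun _ : Fin M => μ) := (integral_finsetSum _ fun U _ => hmaj U).symm
    _ ≤ ∫ ωs : Fin M → Ω, ((2 : ℝ) ^ d) ^ M * (S.card * ((L * δ * d) ^ 2 / 2 +
          2 * ((M : ℝ)⁻¹ ^ 2 * ∑ m, ‖f' x (ωs m)‖ ^ 2))) ∂(Measure.pi fun _ : Fin M => μ) :=
        integral_mono (integrable_finsetSum _ fun U _ => hmaj U)
          (((integrable_const _).add ((hsumintble.const_mul _).const_mul _)).const_mul _
            |>.const_mul _) hpoint
    _ = ((2 : ℝ) ^ d) ^ M * (S.card * ((L * δ * d) ^ 2 / 2 +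
          2 * (∫ ω, ‖f' x ω‖ ^ 2 ∂μ) / M)) := by
        rw [integral_const_mul, integral_const_mul, integral_add (integrable_const _)
          ((hsumintble.const_mul _).const_mul _), integral_const_mul, integral_const_mul, hsumint]
        simp only [integral_const, probReal_univ, one_smul]
        field_simp
    _ ≤ _ := by
        refine mul_le_mul_of_nonneg_left ?_ (by positivity)
        have hSd : (S.card : ℝ) ≤ d := by exact_mod_cast S.card_le_univ.trans_eq (by simp)
        have hSs : (S.card : ℝ) ≤ sbar := by exact_mod_cast hS
        calc (S.card : ℝ) * ((L * δ * d) ^ 2 / 2 + 2 * (∫ ω, ‖f' x ω‖ ^ 2 ∂μ) / M)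
            ≤ d * (L * δ * d) ^ 2 + sbar * (2 * (2 * σ ^ 2 + 2 * ‖Fg‖ ^ 2) / M) := by
              rw [mul_add]
              gcongr
              exact half_le_self (sq_nonneg _)
          _ ≤ L ^ 2 * δ ^ 2 * (d : ℝ) ^ 3
              + 4 * (sbar : ℝ) * (σ ^ 2 + 2 * ‖Fg‖ ^ 2) / M := by
              have h : 0 ≤ (sbar : ℝ) * (4 * ‖Fg‖ ^ 2 / M) := by positivity
              have hsplit : 4 * (sbar : ℝ) * (σ ^ 2 + 2 * ‖Fg‖ ^ 2) / M =
                  sbar * (2 * (2 * σ ^ 2 + 2 * ‖Fg‖ ^ 2) / M) +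
                    sbar * (4 * ‖Fg‖ ^ 2 / M) := by ring
              rw [hsplit]
              linarith
          _ ≤ _ := le_add_of_nonneg_right (by positivity)
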